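/- arXiv:2509.11133 — 4 statements merged into one kernel-verified Lean document; each statement's English description precedes it below -/
import Mathlib

section
/- Let p₀, p₁, p₂, p₃ ∈ ℝ³ be affinely independent, T = conv{p₀, p₁, p₂, p₃}, μ the Lebesgue measure on ℝ³, and let Ct₁, Ct₂, Ct₃, Ct₄ be the centroids of the four triangular faces of T, i.e., the four points (pᵢ + pⱼ + pₖ)/3 over the four 3-element subsets {i,j,k} ⊂ {0,1,2,3}. Then for every affine map f : ℝ³ → ℝ, ∫_T f dμ = (μ(T)/4) · (f(Ct₁) + f(Ct₂) + f(Ct₃) + f(Ct₄)). -/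
open MeasureTheory

/-- An affine function at the centroid of a triangle is the mean of its vertex values. -/
theorem AffineMap.map_triangle_centroid {V : Type*} [AddCommGroup V] [Module ℝ V] (f : V →ᵃ[ℝ] ℝ)
    (x y z : V) : f ((3 : ℝ)⁻¹ • (x + y + z)) = (f x + f y + f z) / 3 := by
  have h (v : V) : f v = f.linear v + f 0 := congrFun f.decomp v
  rw [h, h x, h y, h z, map_smul, map_add, map_add, smul_eq_mul]
  ring

namespace AffineBasis

variable {E ι : Type*} [AddCommGroup E] [Module ℝ E] (b : AffineBasis ι ℝ E)

/-- The affine reflection exchanging the vertices `b i` and `b j`. -/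
noncomputable def swapVertices (i j : ι) : E →ᵃ[ℝ] E :=
  AffineMap.id ℝ E -
    (LinearMap.toSpanSingleton ℝ E (b i - b j)).toAffineMap.comp (b.coord i - b.coord j)

theorem swapVertices_apply (i j : ι) (x : E) :
    b.swapVertices i j x = x - (b.coord i x - b.coord j x) • (b i - b j) := by
  simp [swapVertices, sub_smul]

theorem coord_swapVertices [DecidableEq ι] (i j k : ι) (x : E) :
    b.coord k (b.swapVertices i j x) = b.coord (Equiv.swap i j k) x := by
  have hdir : (b.coord k).linear (b i - b j) = b.coord k (b i) - b.coord k (b j) :=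
    (b.coord k).linearMap_vsub (b i) (b j)
  rw [swapVertices_apply, sub_eq_neg_add, ← vadd_eq_add, AffineMap.map_vadd, map_neg, map_smul,
    hdir, b.coord_apply, b.coord_apply, Equiv.swap_apply_def]
  split_ifs <;> simp_all

theorem swapVertices_involutive [Finite ι] (i j : ι) :
    Function.Involutive (b.swapVertices i j) := by
  classical
  intro x
  refine b.ext_elem fun k => ?_
  rw [coord_swapVertices, coord_swapVertices, Equiv.swap_apply_self]

theorem swapVertices_preimage_convexHull (i j : ι) :
    b.swapVertices i j ⁻¹' convexHull ℝ (Set.range b) = convexHull ℝ (Set.range b) := by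
  classical
  ext x
  simp only [b.convexHull_eq_nonneg_coord, Set.mem_preimage, Set.mem_ofPred_eq, coord_swapVertices]
  exact (Equiv.swap i j).forall_congr_right (q := fun k => 0 ≤ b.coord k x)

theorem sum_coord_mul_apply [Fintype ι] (f : E →ᵃ[ℝ] ℝ) (x : E) :
    ∑ i, b.coord i x * f (b i) = f x := by
  conv_rhs => rw [← b.affineCombination_coord_eq_self x]
  rw [Finset.map_affineCombination _ _ _ (b.sum_coord_apply_eq_one x),
    Finset.affineCombination_eq_linear_combination _ _ _ (b.sum_coord_apply_eq_one x)]
  simp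

end AffineBasis

section AffineBasisIntegral

variable {E ι : Type*} [NormedAddCommGroup E] [NormedSpace ℝ E] [FiniteDimensional ℝ E]
  [MeasurableSpace E] [BorelSpace E] (μ : Measure E) [μ.IsAddHaarMeasure]

/-- An involutive affine map preserves every additive Haar measure. -/
theorem measurePreserving_of_involutive_affineMap (σ : E →ᵃ[ℝ] E)
    (hσ : Function.Involutive σ) : MeasurePreserving σ μ μ := by
  have hcomp : σ.comp σ = AffineMap.id ℝ E := AffineMap.ext hσ
  have hlin : σ.linear ∘ₗ σ.linear = LinearMap.id := congrArg AffineMap.linear hcomp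
  have hdet : LinearMap.det σ.linear * LinearMap.det σ.linear = 1 := by
    rw [← LinearMap.det_comp, hlin, LinearMap.det_id]
  have habs : |(LinearMap.det σ.linear)⁻¹| = 1 := by
    rw [abs_inv, (abs_eq zero_le_one).2 (mul_self_eq_one_iff.1 hdet), inv_one]
  have hL : MeasurePreserving σ.linear μ μ := by
    refine ⟨(LinearMap.continuous_of_finiteDimensional σ.linear).measurable, ?_⟩
    rw [Measure.map_linearMap_addHaar_eq_smul_addHaar μ (left_ne_zero_of_mul_eq_one hdet), habs,
      ENNReal.ofReal_one, one_smul]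
  rw [AffineMap.decomp σ]
  exact (measurePreserving_add_right μ (σ 0)).comp hL

namespace AffineBasis

variable (b : AffineBasis ι ℝ E)

theorem setIntegral_coord_eq [Finite ι] (i j : ι) :
    ∫ x in convexHull ℝ (Set.range b), b.coord i x ∂μ =
      ∫ x in convexHull ℝ (Set.range b), b.coord j x ∂μ := by
  classical
  have hinv := b.swapVertices_involutive i j
  have hmp := measurePreserving_of_involutive_affineMap μ _ hinv
  have hemb := (MeasurableEquiv.ofInvolutive _ hinv hmp.measurable).measurableEmbedding
  have h := hmp.setIntegral_preimage_emb hemb (b.coord i) (convexHull ℝ (Set.range b))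
  simp only [swapVertices_preimage_convexHull, coord_swapVertices, Equiv.swap_apply_left] at h
  exact h.symm

theorem integrableOn_convexHull [Finite ι] (f : E →ᵃ[ℝ] ℝ) :
    IntegrableOn f (convexHull ℝ (Set.range b)) μ :=
  f.continuous_of_finiteDimensional.continuousOn.integrableOn_compact
    ((Set.finite_range b).isCompact_convexHull ℝ)

/-- Each barycentric coordinate has mean `1 / card ι` over the simplex. -/
theorem setIntegral_coord [Fintype ι] (i : ι) :
    ∫ x in convexHull ℝ (Set.range b), b.coord i x ∂μ =
      μ.real (convexHull ℝ (Set.range b)) / Fintype.card ι := by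
  have hsum : ∑ k, ∫ x in convexHull ℝ (Set.range b), b.coord k x ∂μ =
      μ.real (convexHull ℝ (Set.range b)) := by
    rw [← integral_finsetSum _ fun k _ => b.integrableOn_convexHull μ (b.coord k)]
    simp
  have : Nonempty ι := ⟨i⟩
  rw [← hsum, Finset.sum_congr rfl fun k _ => b.setIntegral_coord_eq μ k i, Finset.sum_const,
    Finset.card_univ, nsmul_eq_mul, mul_div_cancel_left₀ _ (by simp)]

/-- Vertex quadrature on a simplex is exact for affine functions. -/
theorem setIntegral_affineMap [Fintype ι] (f : E →ᵃ[ℝ] ℝ) :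
    ∫ x in convexHull ℝ (Set.range b), f x ∂μ =
      μ.real (convexHull ℝ (Set.range b)) / Fintype.card ι * ∑ i, f (b i) := by
  rw [setIntegral_congr_fun ((Set.finite_range b).isCompact_convexHull ℝ).measurableSet
      fun x _ => (b.sum_coord_mul_apply f x).symm,
    integral_finsetSum _ fun k _ => (b.integrableOn_convexHull μ (b.coord k)).mul_const _]
  simp_rw [integral_mul_const, b.setIntegral_coord μ, Finset.mul_sum]

end AffineBasis

end AffineBasisIntegral

/-- Four-point face-centroid quadrature on a tetrahedron is exact for affine functions:
`∫_T f dμ = (μ(T)/4) ∑ f(face centroid)`. -/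
theorem tetrahedron_face_centroid_quadrature
    (p : Fin 4 → EuclideanSpace ℝ (Fin 3)) (hp : AffineIndependent ℝ p)
    (f : EuclideanSpace ℝ (Fin 3) →ᵃ[ℝ] ℝ) :
    ∫ x in convexHull ℝ (Set.range p), f x =
      (volume (convexHull ℝ (Set.range p))).toReal / 4 *
        (f ((3 : ℝ)⁻¹ • (p 0 + p 1 + p 2)) + f ((3 : ℝ)⁻¹ • (p 0 + p 1 + p 3)) +
         f ((3 : ℝ)⁻¹ • (p 0 + p 2 + p 3)) + f ((3 : ℝ)⁻¹ • (p 1 + p 2 + p 3))) := by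
  have hspan : affineSpan ℝ (Set.range p) = ⊤ :=
    hp.affineSpan_eq_top_iff_card_eq_finrank_add_one.2 (by simp)
  let b : AffineBasis (Fin 4) ℝ (EuclideanSpace ℝ (Fin 3)) := ⟨p, hp, hspan⟩
  have h : ∫ x in convexHull ℝ (Set.range p), f x =
      volume.real (convexHull ℝ (Set.range p)) / Fintype.card (Fin 4) * ∑ i, f (p i) :=
    b.setIntegral_affineMap volume f
  rw [h, Fin.sum_univ_four, Fintype.card_fin, Measure.real]
  simp only [AffineMap.map_triangle_centroid]
  push_cast
  ring
end

section
/- Let a, b, c, d ∈ ℝ³ be affinely independent, T = conv{a,b,c,d}, and denote the edge midpoints m_{xy} = (x+y)/2 for each pair of vertices. Let T_a, T_b, T_c, T_d be the four corner subtetrahedra (T_a = conv{a, m_{ab}, m_{ac}, m_{ad}} and similarly for b, c, d) and let Oct = conv{m_{ab}, m_{ac}, m_{ad}, m_{bc}, m_{bd}, m_{cd}} be the convex hull of the six edge midpoints. Then T = T_a ∪ T_b ∪ T_c ∪ T_d ∪ Oct, the pairwise intersections of these five sets are Lebesgue-null, and μ(Oct) = μ(T)/2. -/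
open MeasureTheory

/-- The midpoint of two points. -/
noncomputable def mp (x y : Fin 3 → ℝ) : Fin 3 → ℝ := (2 : ℝ)⁻¹ • (x + y)

/-- The four corner subtetrahedra of `T = conv{a,b,c,d}` together with the midpoint
octahedron. -/
noncomputable def redFivePieces (a b c d : Fin 3 → ℝ) : Fin 5 → Set (Fin 3 → ℝ) :=
  ![convexHull ℝ {a, mp a b, mp a c, mp a d},
    convexHull ℝ {b, mp a b, mp b c, mp b d},
    convexHull ℝ {c, mp a c, mp b c, mp c d},
    convexHull ℝ {d, mp a d, mp b d, mp c d},
    convexHull ℝ {mp a b, mp a c, mp a d, mp b c, mp b d, mp c d}]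

/-- Shrinking a simplex by the factor `1/2` towards its vertex `B i` gives the points of the
simplex whose `i`-th barycentric coordinate is at least `1/2`. -/
theorem AffineBasis.mem_homothety_half_image_convexHull_iff {ι E : Type*} [AddCommGroup E]
    [Module ℝ E] (B : AffineBasis ι ℝ E) (i : ι) (x : E) :
    x ∈ AffineMap.homothety (B i) (2⁻¹ : ℝ) '' convexHull ℝ (Set.range B) ↔
      (∀ j, 0 ≤ B.coord j x) ∧ 2⁻¹ ≤ B.coord i x := by
  classical
  have key : ∀ (r : ℝ) (j : ι) (y : E), B.coord j (AffineMap.homothety (B i) r y) =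
      r * (B.coord j y - if j = i then 1 else 0) + if j = i then 1 else 0 := by
    intro r j y
    rw [AffineMap.homothety_eq_lineMap, AffineMap.apply_lineMap, B.coord_apply,
      AffineMap.lineMap_apply]
    simp
  rw [B.convexHull_eq_nonneg_coord]
  constructor
  · rintro ⟨y, hy, rfl⟩
    simp only [Set.mem_ofPred_eq] at hy
    refine ⟨fun j => ?_, ?_⟩
    · rw [key]
      have := hy j
      split_ifs <;> linarith
    · rw [key]
      have := hy i
      simp only [if_true]
      linarith
  · rintro ⟨h0, hi⟩
    refine ⟨AffineMap.homothety (B i) (2 : ℝ) x, fun j => ?_, ?_⟩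
    · rw [key]
      have := h0 j
      split_ifs with hj
      · subst hj
        linarith
      · linarith
    · rw [← AffineMap.homothety_mul_apply]
      norm_num

theorem AffineBasis.volume_coord_eq {ι : Type*} [Nontrivial ι] {n : ℕ}
    (B : AffineBasis ι ℝ (Fin n → ℝ)) (i : ι) (r : ℝ) :
    volume {x | B.coord i x = r} = 0 := by
  have hs : {x | B.coord i x = r} =
      ((AffineSubspace.mk' r (⊥ : Submodule ℝ ℝ)).comap (B.coord i) : Set (Fin n → ℝ)) := by
    ext x
    simp [AffineSubspace.mem_mk', sub_eq_zero]
  rw [hs]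
  refine Measure.addHaar_affineSubspace _ _ fun htop => ?_
  have hall : ∀ x, B.coord i x = r := fun x => by
    have hx : x ∈ {x | B.coord i x = r} := by
      rw [hs, htop]
      trivial
    exact hx
  obtain ⟨j, hj⟩ := exists_ne i
  have h1 := hall (B i)
  have h2 := hall (B j)
  rw [B.coord_apply_eq] at h1
  rw [B.coord_apply_ne hj.symm] at h2
  linarith

theorem Convex.combination_four_mem {E : Type*} [AddCommGroup E] [Module ℝ E] {s : Set E}
    (hs : Convex ℝ s) {p q r t : E} (hp : p ∈ s) (hq : q ∈ s) (hr : r ∈ s) (ht : t ∈ s)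
    {w x y z : ℝ} (hw : 0 ≤ w) (hx : 0 ≤ x) (hy : 0 ≤ y) (hz : 0 ≤ z)
    (h : w + x + y + z = 1) : w • p + x • q + y • r + z • t ∈ s := by
  have := hs.sum_mem (t := Finset.univ) (w := ![w, x, y, z]) (z := ![p, q, r, t])
    (by intro i _; fin_cases i <;> assumption) (by simpa [Fin.sum_univ_four] using h)
    (by intro i _; fin_cases i <;> assumption)
  simpa [Fin.sum_univ_four] using this

/-- The midpoint octahedron of a tetrahedron is cut out by the inequalities `0 ≤ λ ≤ 1/2` on the
barycentric coordinates `λ`. -/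
theorem mem_convexHull_midpoints_iff (B : AffineBasis (Fin 4) ℝ (Fin 3 → ℝ)) (x : Fin 3 → ℝ) :
    x ∈ convexHull ℝ ({mp (B 0) (B 1), mp (B 0) (B 2), mp (B 0) (B 3), mp (B 1) (B 2),
        mp (B 1) (B 3), mp (B 2) (B 3)} : Set (Fin 3 → ℝ)) ↔
      ∀ j, 0 ≤ B.coord j x ∧ B.coord j x ≤ 2⁻¹ := by
  constructor
  · have hconv : Convex ℝ {x | ∀ j, B.coord j x ∈ Set.Icc (0 : ℝ) 2⁻¹} := by
      rw [Set.ofPred_forall]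
      exact convex_iInter fun j => (convex_Icc (0 : ℝ) 2⁻¹).affine_preimage (B.coord j)
    have hmp : ∀ j k l, B.coord l (mp (B j) (B k)) =
        2⁻¹ * ((if l = j then 1 else 0) + if l = k then 1 else 0) := by
      intro j k l
      have : mp (B j) (B k) = AffineMap.lineMap (B j) (B k) (2⁻¹ : ℝ) := by
        ext i
        simp [mp, AffineMap.lineMap_apply]
        ring
      rw [this, AffineMap.apply_lineMap, B.coord_apply, B.coord_apply, AffineMap.lineMap_apply]
      simp only [vsub_eq_sub, vadd_eq_add, smul_eq_mul]
      ring
    have hmem : ∀ j k, j ≠ k →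
        mp (B j) (B k) ∈ {x | ∀ j, B.coord j x ∈ Set.Icc (0 : ℝ) 2⁻¹} := by
      intro j k hjk l
      rw [hmp]
      split_ifs with hj hk
      · exact absurd (hj.symm.trans hk) hjk
      all_goals norm_num
    refine fun hx => convexHull_min ?_ hconv hx
    intro y hy
    simp only [Set.mem_insert_iff, Set.mem_singleton_iff] at hy
    rcases hy with rfl | rfl | rfl | rfl | rfl | rfl <;> exact hmem _ _ (by decide)
  · intro h
    have hsum : B.coord 0 x + B.coord 1 x + B.coord 2 x + B.coord 3 x = 1 := by
      rw [← B.sum_coord_apply_eq_one x, Fin.sum_univ_four]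
    have hx : B.coord 0 x • B 0 + B.coord 1 x • B 1 + B.coord 2 x • B 2 + B.coord 3 x • B 3
        = x := by
      simpa only [Fin.sum_univ_four] using B.linear_combination_coord_eq_self x
    set s : Set (Fin 3 → ℝ) := {mp (B 0) (B 1), mp (B 0) (B 2), mp (B 0) (B 3), mp (B 1) (B 2),
      mp (B 1) (B 3), mp (B 2) (B 3)} with hs
    have m01 : mp (B 0) (B 1) ∈ convexHull ℝ s := subset_convexHull ℝ s (by simp [hs])
    have m02 : mp (B 0) (B 2) ∈ convexHull ℝ s := subset_convexHull ℝ s (by simp [hs])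
    have m03 : mp (B 0) (B 3) ∈ convexHull ℝ s := subset_convexHull ℝ s (by simp [hs])
    have m12 : mp (B 1) (B 2) ∈ convexHull ℝ s := subset_convexHull ℝ s (by simp [hs])
    have m13 : mp (B 1) (B 3) ∈ convexHull ℝ s := subset_convexHull ℝ s (by simp [hs])
    have m23 : mp (B 2) (B 3) ∈ convexHull ℝ s := subset_convexHull ℝ s (by simp [hs])
    have hS := convex_convexHull ℝ s
    obtain ⟨⟨a0, a1⟩, ⟨b0, b1⟩, ⟨c0, c1⟩, ⟨d0, d1⟩⟩ := And.intro (h 0) (And.intro (h 1)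
      (And.intro (h 2) (h 3)))
    generalize B.coord 0 x = p at *
    generalize B.coord 1 x = q at *
    generalize B.coord 2 x = r at *
    generalize B.coord 3 x = t at *
    obtain rfl : t = 1 - p - q - r := by linarith
    rcases le_total (q + (1 - p - q - r)) 2⁻¹ with h13 | h13 <;>
      rcases le_total (q + r) 2⁻¹ with h12 | h12
    · convert hS.combination_four_mem m01 m23 m02 m03 (w := 2 * q) (x := 1 - 2 * p)
        (y := 2 * (p + r) - 1) (z := 1 - 2 * (q + r)) (by linarith) (by linarith)
        (by linarith) (by linarith) (by ring) using 1
      rw [← hx]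
      ext i
      simp only [mp, Pi.add_apply, Pi.smul_apply, smul_eq_mul]
      ring
    · convert hS.combination_four_mem m01 m23 m02 m12 (w := 1 - 2 * r)
        (x := 2 * (1 - p - q - r)) (y := 2 * (p + r) - 1) (z := 2 * (q + r) - 1) (by linarith)
        (by linarith) (by linarith) (by linarith) (by ring) using 1
      rw [← hx]
      ext i
      simp only [mp, Pi.add_apply, Pi.smul_apply, smul_eq_mul]
      ring
    · convert hS.combination_four_mem m01 m23 m03 m13 (w := 2 * (p + q + r) - 1)
        (x := 2 * r) (y := 1 - 2 * (q + r)) (z := 1 - 2 * (p + r)) (by linarith)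
        (by linarith) (by linarith) (by linarith) (by ring) using 1
      rw [← hx]
      ext i
      simp only [mp, Pi.add_apply, Pi.smul_apply, smul_eq_mul]
      ring
    · convert hS.combination_four_mem m01 m23 m12 m13 (w := 2 * p) (x := 1 - 2 * q)
        (y := 2 * (q + r) - 1) (z := 1 - 2 * (p + r)) (by linarith) (by linarith)
        (by linarith) (by linarith) (by ring) using 1
      rw [← hx]
      ext i
      simp only [mp, Pi.add_apply, Pi.smul_apply, smul_eq_mul]
      ring

/-- First stage of the red refinement: the four corner subtetrahedra and the midpoint
octahedron cover `T`, overlap only in Lebesgue-null sets, and the octahedron has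
half the volume of `T`. -/
theorem corner_tetrahedra_and_octahedron
    (a b c d : Fin 3 → ℝ) (h : AffineIndependent ℝ ![a, b, c, d]) :
    (⋃ i, redFivePieces a b c d i) = convexHull ℝ {a, b, c, d} ∧
    (Pairwise fun i j : Fin 5 =>
      volume (redFivePieces a b c d i ∩ redFivePieces a b c d j) = 0) ∧
    volume (convexHull ℝ
        ({mp a b, mp a c, mp a d, mp b c, mp b d, mp c d} : Set (Fin 3 → ℝ))) =
      volume (convexHull ℝ ({a, b, c, d} : Set (Fin 3 → ℝ))) / 2 := by
  have htop : affineSpan ℝ (Set.range ![a, b, c, d]) = ⊤ := by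
    rw [h.affineSpan_eq_top_iff_card_eq_finrank_add_one]
    simp
  let B : AffineBasis (Fin 4) ℝ (Fin 3 → ℝ) := ⟨![a, b, c, d], h, htop⟩
  have hB : ⇑B = ![a, b, c, d] := rfl
  have hrange : Set.range B = {a, b, c, d} := by
    rw [hB]
    simp only [Matrix.range_cons, Matrix.range_empty, Set.union_empty, Set.singleton_union]
  set T : Set (Fin 3 → ℝ) := convexHull ℝ {a, b, c, d} with hT
  have mem_T : ∀ x, x ∈ T ↔ ∀ j, 0 ≤ B.coord j x := fun x => by
    rw [hT, ← hrange, B.convexHull_eq_nonneg_coord]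
    rfl
  have hhom : ∀ p q : Fin 3 → ℝ, AffineMap.homothety p (2⁻¹ : ℝ) q = mp p q := fun p q => by
    ext i
    simp [mp, AffineMap.homothety_apply]
    ring
  have hcomm : ∀ p q, mp p q = mp q p := fun p q => by rw [mp, mp, add_comm]
  have hself : ∀ p, mp p p = p := fun p => by
    rw [mp, ← two_smul ℝ p, smul_smul]
    norm_num
  have hcorner : ∀ p, AffineMap.homothety p (2⁻¹ : ℝ) '' T =
      convexHull ℝ {mp p a, mp p b, mp p c, mp p d} := fun p => by
    rw [hT, AffineMap.image_convexHull]
    simp only [Set.image_insert_eq, Set.image_singleton, hhom]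
  have hpieces : ∀ i : Fin 4, redFivePieces a b c d i.castSucc =
      AffineMap.homothety (B i) (2⁻¹ : ℝ) '' T := fun i => by
    rw [hcorner, hB]
    fin_cases i
    · simp [redFivePieces, hself]
    · simp [redFivePieces, hself, hcomm b a, Set.insert_comm b]
    · simp [redFivePieces, hself, hcomm c a, hcomm c b, Set.insert_comm c]
    · simp [redFivePieces, hself, hcomm d a, hcomm d b, hcomm d c, Set.insert_comm d,
        Set.pair_comm d]
  have mem_corner : ∀ (i : Fin 4) x, x ∈ redFivePieces a b c d i.castSucc ↔
      (∀ j, 0 ≤ B.coord j x) ∧ 2⁻¹ ≤ B.coord i x := fun i x => by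
    rw [hpieces, hT, ← hrange, B.mem_homothety_half_image_convexHull_iff]
  have mem_oct : ∀ x, x ∈ redFivePieces a b c d (Fin.last 4) ↔
      ∀ j, 0 ≤ B.coord j x ∧ B.coord j x ≤ 2⁻¹ := fun x => mem_convexHull_midpoints_iff B x
  have hcover : (⋃ i, redFivePieces a b c d i) = T := by
    ext x
    rw [Set.mem_iUnion, mem_T]
    constructor
    · rintro ⟨i, hi⟩
      induction i using Fin.lastCases with
      | last => exact fun j => ((mem_oct x).1 hi j).1
      | cast i => exact ((mem_corner i x).1 hi).1
    · intro hx
      by_cases hj : ∃ j, 2⁻¹ ≤ B.coord j x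
      · obtain ⟨j, hj⟩ := hj
        exact ⟨_, (mem_corner j x).2 ⟨hx, hj⟩⟩
      · push Not at hj
        exact ⟨_, (mem_oct x).2 fun j => ⟨hx j, (hj j).le⟩⟩
  have hcast : ∀ (i : Fin 4) (j : Fin 5), i.castSucc ≠ j →
      volume (redFivePieces a b c d i.castSucc ∩ redFivePieces a b c d j) = 0 := by
    intro i j hij
    refine measure_mono_null ?_ (B.volume_coord_eq i 2⁻¹)
    rintro x ⟨hxi, hxj⟩
    rw [mem_corner] at hxi
    refine le_antisymm ?_ hxi.2
    induction j using Fin.lastCases with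
    | last => exact ((mem_oct x).1 hxj i).2
    | cast j =>
      have hne : i ≠ j := fun hij' => hij (by rw [hij'])
      have hle : ∑ k ∈ {i, j}, B.coord k x ≤ ∑ k, B.coord k x :=
        Finset.sum_le_sum_of_subset_of_nonneg (Finset.subset_univ _) fun k _ _ => hxi.1 k
      rw [Finset.sum_pair hne, B.sum_coord_apply_eq_one] at hle
      have := ((mem_corner j x).1 hxj).2
      norm_num at *
      linarith
  have hnull : Pairwise fun i j : Fin 5 =>
      volume (redFivePieces a b c d i ∩ redFivePieces a b c d j) = 0 := by
    intro i j hij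
    induction i using Fin.lastCases with
    | cast i => exact hcast i j hij
    | last =>
      induction j using Fin.lastCases with
      | last => exact absurd rfl hij
      | cast j =>
        rw [Set.inter_comm]
        exact hcast j _ hij.symm
  refine ⟨hcover, hnull, ?_⟩
  have hconv : ∀ i, Convex ℝ (redFivePieces a b c d i) := fun i => by
    fin_cases i <;> exact convex_convexHull ℝ _
  have hvol : volume T = ∑ i, volume (redFivePieces a b c d i) := by
    rw [← hcover, measure_iUnion₀ hnull fun i => (hconv i).nullMeasurableSet volume, tsum_fintype]
  have hfin : volume T ≠ ⊤ :=
    ((Set.toFinite {a, b, c, d}).isCompact_convexHull (𝕜 := ℝ)).measure_lt_top.ne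
  have hcvol : ∀ i : Fin 4, volume (redFivePieces a b c d i.castSucc) =
      ENNReal.ofReal 8⁻¹ * volume T := fun i => by
    rw [hpieces, Measure.addHaar_image_homothety]
    norm_num
  rw [Fin.sum_univ_castSucc] at hvol
  simp only [hcvol, Finset.sum_const, Finset.card_univ, Fintype.card_fin, nsmul_eq_mul] at hvol
  change volume (redFivePieces a b c d (Fin.last 4)) = _
  generalize volume (redFivePieces a b c d (Fin.last 4)) = v at *
  have hv : v ≠ ⊤ := by
    rintro rfl
    simp at hvol
    exact hfin hvol
  lift v to NNReal using hv
  generalize volume T = w at *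
  lift w to NNReal using hfin
  have hreal := congrArg ENNReal.toReal hvol
  rw [ENNReal.toReal_add (by finiteness) (by finiteness)] at hreal
  simp only [ENNReal.toReal_mul, ENNReal.coe_toReal] at hreal
  rw [ENNReal.toReal_ofReal (by norm_num)] at hreal
  norm_num at hreal
  rw [← ENNReal.toReal_eq_toReal_iff' (by finiteness) (by finiteness), ENNReal.toReal_div]
  simp only [ENNReal.coe_toReal, ENNReal.toReal_ofNat]
  linarith
end

section
/- Let a, b, c, d ∈ ℝ³ be affinely independent, T = conv{a,b,c,d}, m_{xy} = (x+y)/2 the edge midpoints, c_T = (a+b+c+d)/4 the centroid, and Oct = conv{m_{ab}, m_{ac}, m_{ad}, m_{bc}, m_{bd}, m_{cd}}. Consider the eight tetrahedra conv{m_{ab}, m_{ac}, m_{ad}, c_T}, conv{m_{bc}, m_{ab}, m_{bd}, c_T}, conv{m_{ac}, m_{bc}, m_{cd}, c_T}, conv{m_{cd}, m_{bd}, m_{ad}, c_T}, conv{m_{ab}, m_{bc}, m_{ac}, c_T}, conv{m_{ac}, m_{cd}, m_{ad}, c_T}, conv{m_{ab}, m_{ad}, m_{bd}, c_T}, conv{m_{cd},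 m_{bc}, m_{bd}, c_T}. Their union equals Oct, their pairwise intersections are Lebesgue-null, and each of them has Lebesgue measure μ(T)/16. -/
open MeasureTheory

/-- The centroid of the tetrahedron with vertices `a, b, c, d`. -/
noncomputable def cT (a b c d : Fin 3 → ℝ) : Fin 3 → ℝ := (4 : ℝ)⁻¹ • (a + b + c + d)

/-- The eight tetrahedra joining the faces of the midpoint octahedron to the centroid. -/
noncomputable def octPieces (a b c d : Fin 3 → ℝ) : Fin 8 → Set (Fin 3 → ℝ) :=
  ![convexHull ℝ {mp a b, mp a c, mp a d, cT a b c d},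
    convexHull ℝ {mp b c, mp a b, mp b d, cT a b c d},
    convexHull ℝ {mp a c, mp b c, mp c d, cT a b c d},
    convexHull ℝ {mp c d, mp b d, mp a d, cT a b c d},
    convexHull ℝ {mp a b, mp b c, mp a c, cT a b c d},
    convexHull ℝ {mp a c, mp c d, mp a d, cT a b c d},
    convexHull ℝ {mp a b, mp a d, mp b d, cT a b c d},
    convexHull ℝ {mp c d, mp b c, mp b d, cT a b c d}]

/-- The affine map with origin `o` and axes `u, v, w`. -/
noncomputable def frame (u v w o : Fin 3 → ℝ) (x : Fin 3 → ℝ) : Fin 3 → ℝ :=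
  o + (x 0 • u + x 1 • v + x 2 • w)

/-- The corner simplex with vertices `0` and the standard basis vectors. -/
def cornerSimplex : Set (Fin 3 → ℝ) := {x | (∀ k, 0 ≤ x k) ∧ x 0 + x 1 + x 2 ≤ 1}

theorem frame_eq_vecMul (u v w o x : Fin 3 → ℝ) :
    frame u v w o x = o + Matrix.vecMul x (Matrix.of ![u, v, w]) := by
  ext k
  simp only [frame, Matrix.vecMul, dotProduct, Fin.sum_univ_three, Pi.add_apply, Pi.smul_apply,
    smul_eq_mul, Matrix.of_apply, Matrix.cons_val]

theorem volume_frame_image (u v w o : Fin 3 → ℝ) (s : Set (Fin 3 → ℝ)) :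
    volume (frame u v w o '' s) =
      ENNReal.ofReal |(Matrix.of ![u, v, w]).det| * volume s := by
  have himage : frame u v w o '' s =
      (fun y => o + y) '' (Matrix.toLin' (Matrix.of ![u, v, w]).transpose '' s) := by
    rw [Set.image_image]
    refine Set.image_congr fun x _ => ?_
    rw [frame_eq_vecMul, Matrix.toLin'_apply, Matrix.mulVec_transpose]
  rw [himage, Set.image_add_left, measure_preimage_add, Measure.addHaar_image_linearMap,
    LinearMap.det_toLin', Matrix.det_transpose]

theorem frame_injective {u v w : Fin 3 → ℝ} (o : Fin 3 → ℝ)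
    (hdet : (Matrix.of ![u, v, w]).det ≠ 0) : Function.Injective (frame u v w o) := by
  intro x y hxy
  rw [frame_eq_vecMul, frame_eq_vecMul] at hxy
  exact Matrix.vecMul_injective_of_isUnit
    ((Matrix.isUnit_iff_isUnit_det _).2 (isUnit_iff_ne_zero.2 hdet)) (add_left_cancel hxy)

theorem frame_combo (u v w o x y : Fin 3 → ℝ) {s t : ℝ} (hst : s + t = 1) :
    frame u v w o (s • x + t • y) = s • frame u v w o x + t • frame u v w o y := by
  obtain rfl : t = 1 - s := by linarith
  ext k
  simp only [frame, Pi.add_apply, Pi.smul_apply, smul_eq_mul]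
  ring

theorem Convex.frame_image {s : Set (Fin 3 → ℝ)} (hs : Convex ℝ s) (u v w o : Fin 3 → ℝ) :
    Convex ℝ (frame u v w o '' s) := by
  rintro _ ⟨x, hx, rfl⟩ _ ⟨y, hy, rfl⟩ p q hp hq hpq
  exact ⟨p • x + q • y, hs hx hy hp hq hpq, frame_combo u v w o x y hpq⟩

theorem convex_cornerSimplex : Convex ℝ cornerSimplex := by
  rintro x ⟨hx, hx'⟩ y ⟨hy, hy'⟩ p q hp hq hpq
  refine ⟨fun k => ?_, ?_⟩
  · have := mul_nonneg hp (hx k)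
    have := mul_nonneg hq (hy k)
    simp only [Pi.add_apply, Pi.smul_apply, smul_eq_mul]
    linarith
  · simp only [Pi.add_apply, Pi.smul_apply, smul_eq_mul]
    nlinarith

theorem convexHull_eq_frame_image (u v w o : Fin 3 → ℝ) :
    convexHull ℝ {o + u, o + v, o + w, o} = frame u v w o '' cornerSimplex := by
  refine Set.Subset.antisymm
    (convexHull_min ?_ (convex_cornerSimplex.frame_image u v w o)) ?_
  · rintro y (rfl | rfl | rfl | rfl)
    · exact ⟨![1, 0, 0], by simp [cornerSimplex, Fin.forall_fin_succ], by simp [frame]⟩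
    · exact ⟨![0, 1, 0], by simp [cornerSimplex, Fin.forall_fin_succ], by simp [frame]⟩
    · exact ⟨![0, 0, 1], by simp [cornerSimplex, Fin.forall_fin_succ], by simp [frame]⟩
    · exact ⟨0, by simp [cornerSimplex], by simp [frame]⟩
  · rintro _ ⟨x, ⟨hx, hx'⟩, rfl⟩
    have hsum := (convex_convexHull ℝ ({o + u, o + v, o + w, o} : Set (Fin 3 → ℝ))).sum_mem
      (t := Finset.univ) (w := ![x 0, x 1, x 2, 1 - (x 0 + x 1 + x 2)])
      (z := ![o + u, o + v, o + w, o])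
      (by simp [Fin.forall_fin_succ, hx, hx'])
      (by simp [Fin.sum_univ_four])
      (fun i _ => subset_convexHull ℝ _ (by fin_cases i <;> simp))
    convert hsum using 1
    ext k
    simp only [frame, Fin.sum_univ_four, Pi.add_apply, Pi.smul_apply, smul_eq_mul,
      Matrix.cons_val]
    ring

theorem volume_convexHull_four (p q r s : Fin 3 → ℝ) :
    volume (convexHull ℝ {p, q, r, s}) =
      ENNReal.ofReal |(Matrix.of ![p - s, q - s, r - s]).det| * volume cornerSimplex := by
  rw [← volume_frame_image _ _ _ s, ← convexHull_eq_frame_image]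
  simp

/-- The signs of the octants occupied by the pieces of the octahedron. -/
def octSign : Fin 8 → Fin 3 → ℝ :=
  ![![1, 1, 1], ![1, -1, -1], ![-1, 1, -1], ![-1, -1, 1],
    ![1, 1, -1], ![-1, 1, 1], ![1, -1, 1], ![-1, -1, -1]]

theorem octSign_eq_or (i : Fin 8) (k : Fin 3) : octSign i k = 1 ∨ octSign i k = -1 := by
  fin_cases i <;> fin_cases k <;> simp [octSign]

theorem exists_octSign_eq_neg {i j : Fin 8} (hij : i ≠ j) :
    ∃ k, octSign i k = -octSign j k := by
  have hne : octSign i ≠ octSign j := by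
    intro heq
    have h0 := congrFun heq 0
    have h1 := congrFun heq 1
    have h2 := congrFun heq 2
    clear heq
    fin_cases i <;> fin_cases j <;> first | exact hij rfl | skip
    all_goals
      simp only [octSign, Fin.reduceFinMk, Fin.zero_eta, Fin.mk_one, Matrix.cons_val] at h0 h1 h2
      linarith
  obtain ⟨k, hk⟩ := Function.ne_iff.1 hne
  refine ⟨k, ?_⟩
  rcases octSign_eq_or i k with hi | hi <;> rcases octSign_eq_or j k with hj | hj <;>
    simp_all

theorem exists_octSign_mul_eq_abs (x : Fin 3 → ℝ) : ∃ i, ∀ k, octSign i k * x k = |x k| := by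
  have hsign (t : ℝ) : 1 * t = |t| ∨ -1 * t = |t| := by
    rcases abs_choice t with ht | ht <;> simp [ht]
  rcases hsign (x 0) with h0 | h0 <;> rcases hsign (x 1) with h1 | h1 <;>
    rcases hsign (x 2) with h2 | h2
  · exact ⟨0, Fin.forall_fin_succ.2 ⟨h0, Fin.forall_fin_two.2 ⟨h1, h2⟩⟩⟩
  · exact ⟨4, Fin.forall_fin_succ.2 ⟨h0, Fin.forall_fin_two.2 ⟨h1, h2⟩⟩⟩
  · exact ⟨6, Fin.forall_fin_succ.2 ⟨h0, Fin.forall_fin_two.2 ⟨h1, h2⟩⟩⟩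
  · exact ⟨1, Fin.forall_fin_succ.2 ⟨h0, Fin.forall_fin_two.2 ⟨h1, h2⟩⟩⟩
  · exact ⟨5, Fin.forall_fin_succ.2 ⟨h0, Fin.forall_fin_two.2 ⟨h1, h2⟩⟩⟩
  · exact ⟨2, Fin.forall_fin_succ.2 ⟨h0, Fin.forall_fin_two.2 ⟨h1, h2⟩⟩⟩
  · exact ⟨3, Fin.forall_fin_succ.2 ⟨h0, Fin.forall_fin_two.2 ⟨h1, h2⟩⟩⟩
  · exact ⟨7, Fin.forall_fin_succ.2 ⟨h0, Fin.forall_fin_two.2 ⟨h1, h2⟩⟩⟩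

/-- The part of the unit octahedron in the `i`-th octant. -/
def octantSimplex (i : Fin 8) : Set (Fin 3 → ℝ) := {x | octSign i * x ∈ cornerSimplex}

theorem frame_octSign (i : Fin 8) (u v w o x : Fin 3 → ℝ) :
    frame (octSign i 0 • u) (octSign i 1 • v) (octSign i 2 • w) o x =
      frame u v w o (octSign i * x) := by
  simp [frame, smul_smul, mul_comm]

theorem octSign_mul_octSign_mul (i : Fin 8) (x : Fin 3 → ℝ) :
    octSign i * (octSign i * x) = x := by
  ext k
  rcases octSign_eq_or i k with hi | hi <;> simp [hi]

theorem frame_octSign_image (i : Fin 8) (u v w o : Fin 3 → ℝ) :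
    frame (octSign i 0 • u) (octSign i 1 • v) (octSign i 2 • w) o '' cornerSimplex =
      frame u v w o '' octantSimplex i := by
  ext y
  constructor
  · rintro ⟨x, hx, rfl⟩
    refine ⟨octSign i * x, ?_, (frame_octSign i u v w o x).symm⟩
    simpa [octantSimplex, octSign_mul_octSign_mul] using hx
  · rintro ⟨x, hx, rfl⟩
    refine ⟨octSign i * x, hx, ?_⟩
    rw [frame_octSign, octSign_mul_octSign_mul]

theorem volume_octantSimplex_inter {i j : Fin 8} (hij : i ≠ j) :
    volume (octantSimplex i ∩ octantSimplex j) = 0 := by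
  obtain ⟨k, hk⟩ := exists_octSign_eq_neg hij
  refine measure_mono_null (t := {x | x k = 0}) ?_ ?_
  · rintro x ⟨hi, hj⟩
    have hi := hi.1 k
    have hj := hj.1 k
    simp only [Pi.mul_apply, hk] at hi hj
    rcases octSign_eq_or j k with h | h <;> simp only [h] at hi hj <;>
      simp only [Set.mem_ofPred_eq] <;> linarith
  · exact Measure.pi_hyperplane (fun _ : Fin 3 => (volume : Measure ℝ)) k 0

theorem convex_abs_add_abs_add_abs_le :
    Convex ℝ {x : Fin 3 → ℝ | |x 0| + |x 1| + |x 2| ≤ 1} := by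
  intro x hx y hy p q hp hq hpq
  have hk (k : Fin 3) : |p * x k + q * y k| ≤ p * |x k| + q * |y k| := by
    refine (abs_add_le _ _).trans_eq ?_
    rw [abs_mul, abs_mul, abs_of_nonneg hp, abs_of_nonneg hq]
  have h0 := hk 0
  have h1 := hk 1
  have h2 := hk 2
  simp only [Set.mem_ofPred_eq, Pi.add_apply, Pi.smul_apply, smul_eq_mul] at hx hy ⊢
  nlinarith

section Midpoints

variable (a b c d : Fin 3 → ℝ)

theorem mp_bc_eq : mp b c = cT a b c d + -(mp a d - cT a b c d) := by
  ext k
  simp [mp, cT]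
  ring

theorem mp_bd_eq : mp b d = cT a b c d + -(mp a c - cT a b c d) := by
  ext k
  simp [mp, cT]
  ring

theorem mp_cd_eq : mp c d = cT a b c d + -(mp a b - cT a b c d) := by
  ext k
  simp [mp, cT]
  ring

/-- Coordinates centred at the centroid, with axes through the midpoints of the edges at `a`. -/
noncomputable def centroidFrame : (Fin 3 → ℝ) → Fin 3 → ℝ :=
  frame (mp a b - cT a b c d) (mp a c - cT a b c d) (mp a d - cT a b c d) (cT a b c d)

theorem octPieces_eq_convexHull (i : Fin 8) :
    octPieces a b c d i = convexHull ℝ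
      {cT a b c d + octSign i 0 • (mp a b - cT a b c d),
        cT a b c d + octSign i 1 • (mp a c - cT a b c d),
        cT a b c d + octSign i 2 • (mp a d - cT a b c d), cT a b c d} := by
  have hbc := mp_bc_eq a b c d
  have hbd := mp_bd_eq a b c d
  have hcd := mp_cd_eq a b c d
  fin_cases i <;> simp only [octPieces, octSign, Fin.reduceFinMk, Fin.zero_eta, Fin.mk_one,
      Matrix.cons_val, one_smul, neg_smul, ← hbc, ← hbd, ← hcd, add_sub_cancel] <;>
    congr 1 <;> ext y <;> simp only [Set.mem_insert_iff, Set.mem_singleton_iff] <;> tauto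

theorem octPieces_eq_image (i : Fin 8) :
    octPieces a b c d i = centroidFrame a b c d '' octantSimplex i := by
  rw [octPieces_eq_convexHull, convexHull_eq_frame_image, frame_octSign_image, centroidFrame]

theorem volume_octPieces (i : Fin 8) :
    volume (octPieces a b c d i) =
      volume (convexHull ℝ ({a, b, c, d} : Set (Fin 3 → ℝ))) / 16 := by
  set u := mp a b - cT a b c d with hu
  set v := mp a c - cT a b c d with hv
  set w := mp a d - cT a b c d with hw
  have hpiece : |(Matrix.of ![octSign i 0 • u, octSign i 1 • v, octSign i 2 • w]).det| =
      |(Matrix.of ![u, v, w]).det| := by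
    have hdet : (Matrix.of ![octSign i 0 • u, octSign i 1 • v, octSign i 2 • w]).det =
        octSign i 0 * octSign i 1 * octSign i 2 * (Matrix.of ![u, v, w]).det := by
      simp [Matrix.det_fin_three]
      ring
    rw [hdet, abs_mul, abs_mul, abs_mul]
    rcases octSign_eq_or i 0 with h0 | h0 <;> rcases octSign_eq_or i 1 with h1 | h1 <;>
      rcases octSign_eq_or i 2 with h2 | h2 <;> simp [h0, h1, h2]
  have htetra : |(Matrix.of ![a - d, b - d, c - d]).det| =
      16 * |(Matrix.of ![u, v, w]).det| := by
    have hdet : (Matrix.of ![a - d, b - d, c - d]).det =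
        16 * (Matrix.of ![u, v, w]).det := by
      simp [Matrix.det_fin_three, hu, hv, hw, mp, cT]
      ring
    rw [hdet, abs_mul, abs_of_pos (by norm_num : (0 : ℝ) < 16)]
  rw [octPieces_eq_convexHull, convexHull_eq_frame_image, volume_frame_image, hpiece,
    volume_convexHull_four, htetra, ENNReal.ofReal_mul (by norm_num), mul_assoc,
    ENNReal.ofReal_ofNat, mul_comm 16, ENNReal.mul_div_cancel_right (by norm_num) (by norm_num)]

theorem volume_octPieces_inter {i j : Fin 8} (hij : i ≠ j) :
    volume (octPieces a b c d i ∩ octPieces a b c d j) = 0 := by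
  rw [octPieces_eq_image, octPieces_eq_image]
  by_cases hdet : (Matrix.of ![mp a b - cT a b c d, mp a c - cT a b c d,
      mp a d - cT a b c d]).det = 0
  · refine measure_mono_null Set.inter_subset_left ?_
    rw [centroidFrame, volume_frame_image, hdet]
    simp
  · rw [centroidFrame, ← Set.image_inter (frame_injective _ hdet), volume_frame_image,
      volume_octantSimplex_inter hij, mul_zero]

theorem iUnion_octPieces :
    (⋃ i, octPieces a b c d i) =
      convexHull ℝ {mp a b, mp a c, mp a d, mp b c, mp b d, mp c d} := by
  refine Set.Subset.antisymm (Set.iUnion_subset fun i => ?_) ?_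
  · have hvertex : ({mp a b, mp a c, mp a d, mp b c, mp b d, mp c d} : Set (Fin 3 → ℝ)) ⊆
        convexHull ℝ {mp a b, mp a c, mp a d, mp b c, mp b d, mp c d} :=
      subset_convexHull ℝ _
    have hcentroid :
        cT a b c d ∈ convexHull ℝ {mp a b, mp a c, mp a d, mp b c, mp b d, mp c d} := by
      have hmid := convex_convexHull ℝ _ (hvertex (a := mp a b) (by simp))
        (hvertex (a := mp c d) (by simp)) (a := 1 / 2) (b := 1 / 2)
        (by norm_num) (by norm_num) (by norm_num)
      convert hmid using 1
      ext k
      simp [mp, cT]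
      ring
    fin_cases i <;> refine convexHull_min ?_ (convex_convexHull ℝ _) <;>
      rintro y (rfl | rfl | rfl | rfl) <;>
      first | exact hcentroid | exact hvertex (by simp)
  · have hsubset : centroidFrame a b c d '' {x | |x 0| + |x 1| + |x 2| ≤ 1} ⊆
        ⋃ i, octPieces a b c d i := by
      rintro _ ⟨x, hx, rfl⟩
      obtain ⟨i, hi⟩ := exists_octSign_mul_eq_abs x
      rw [Set.mem_iUnion]
      refine ⟨i, ?_⟩
      rw [octPieces_eq_image]
      refine ⟨x, ⟨fun k => ?_, ?_⟩, rfl⟩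
      · simp [hi]
      · simpa [hi] using hx
    refine (convexHull_min ?_ (convex_abs_add_abs_add_abs_le.frame_image _ _ _ _)).trans hsubset
    rw [mp_bc_eq a b c d, mp_bd_eq a b c d, mp_cd_eq a b c d]
    rintro y (rfl | rfl | rfl | rfl | rfl | rfl)
    · exact ⟨![1, 0, 0], by simp, by simp [frame]⟩
    · exact ⟨![0, 1, 0], by simp, by simp [frame]⟩
    · exact ⟨![0, 0, 1], by simp, by simp [frame]⟩
    · exact ⟨![0, 0, -1], by simp, by simp [frame]⟩
    · exact ⟨![0, -1, 0], by simp, by simp [frame]⟩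
    · exact ⟨![-1, 0, 0], by simp, by simp [frame]⟩

end Midpoints

/-- Second stage of the red refinement: the eight centroid tetrahedra cover the midpoint
octahedron, overlap only in Lebesgue-null sets, and each has volume `μ(T)/16`. -/
theorem octahedron_subdivision
    (a b c d : Fin 3 → ℝ) (h : AffineIndependent ℝ ![a, b, c, d]) :
    (⋃ i, octPieces a b c d i) =
      convexHull ℝ {mp a b, mp a c, mp a d, mp b c, mp b d, mp c d} ∧
    (Pairwise fun i j : Fin 8 =>
      volume (octPieces a b c d i ∩ octPieces a b c d j) = 0) ∧
    (∀ i, volume (octPieces a b c d i) =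
      volume (convexHull ℝ ({a, b, c, d} : Set (Fin 3 → ℝ))) / 16) :=
  ⟨iUnion_octPieces a b c d, fun _ _ => volume_octPieces_inter a b c d, volume_octPieces a b c d⟩
end

section
/- Let a, b, c, d ∈ ℝ³ be affinely independent, T = conv{a,b,c,d}, m_{xy} = (x+y)/2 the edge midpoints, and c_T = (a+b+c+d)/4 the centroid. Consider the twelve tetrahedra of the red refinement: the four corner tetrahedra conv{a, m_{ab}, m_{ac}, m_{ad}}, conv{b, m_{bc}, m_{ab}, m_{bd}}, conv{c, m_{ac}, m_{bc}, m_{cd}}, conv{d, m_{cd}, m_{bd}, m_{ad}}, together with the eight centroid tetrahedra conv{m_{ab}, m_{ac}, m_{ad}, c_T}, conv{m_{bc}, m_{ab}, m_{bd}, c_T}, conv{m_{ac}, m_{bc}, m_{cd}, c_T}, conv{m_{cd}, m_{bd}, m_{ad}, c_T}, conv{m_{ab}, m_{bc}, m_{ac}, c_T}, conv{m_{ac}, m_{cd}, m_{ad}, c_T}, conv{m_{ab}, m_{ad}, m_{bd}, c_T}, conv{m_{cd}, m_{bc}, m_{bd}, c_T}. Then the union of these twelve tetrahedra equals T, their pairwise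 intersections are Lebesgue-null, and their Lebesgue measures sum to μ(T). -/
open MeasureTheory

/-- The twelve subtetrahedra of the red refinement: four corner tetrahedra and eight
centroid tetrahedra. -/
noncomputable def redPieces (a b c d : Fin 3 → ℝ) : Fin 12 → Set (Fin 3 → ℝ) :=
  ![convexHull ℝ {a, mp a b, mp a c, mp a d},
    convexHull ℝ {b, mp b c, mp a b, mp b d},
    convexHull ℝ {c, mp a c, mp b c, mp c d},
    convexHull ℝ {d, mp c d, mp b d, mp a d},
    convexHull ℝ {mp a b, mp a c, mp a d, cT a b c d},
    convexHull ℝ {mp b c, mp a b, mp b d, cT a b c d},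
    convexHull ℝ {mp a c, mp b c, mp c d, cT a b c d},
    convexHull ℝ {mp c d, mp b d, mp a d, cT a b c d},
    convexHull ℝ {mp a b, mp b c, mp a c, cT a b c d},
    convexHull ℝ {mp a c, mp c d, mp a d, cT a b c d},
    convexHull ℝ {mp a b, mp a d, mp b d, cT a b c d},
    convexHull ℝ {mp c d, mp b c, mp b d, cT a b c d}]

section ConvexHull

variable {E : Type*} [AddCommGroup E] [Module ℝ E]

theorem mem_convexHull_four_of_eq {p q r s x : E} {t u v w : ℝ} (ht : 0 ≤ t) (hu : 0 ≤ u)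
    (hv : 0 ≤ v) (hw : 0 ≤ w) (hsum : t + u + v + w = 1)
    (hx : t • p + u • q + v • r + w • s = x) : x ∈ convexHull ℝ {p, q, r, s} := by
  refine mem_convexHull_of_exists_fintype ![t, u, v, w] ![p, q, r, s] ?_ ?_ ?_ ?_
  · intro i
    fin_cases i <;> simpa
  · simpa [Fin.sum_univ_four] using hsum
  · intro i
    fin_cases i <;> simp
  · simpa [Fin.sum_univ_four] using hx

theorem exists_weights_of_mem_convexHull_four {p q r s x : E}
    (hx : x ∈ convexHull ℝ {p, q, r, s}) :
    ∃ t u v w : ℝ, 0 ≤ t ∧ 0 ≤ u ∧ 0 ≤ v ∧ 0 ≤ w ∧ t + u + v + w = 1 ∧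
      t • p + u • q + v • r + w • s = x := by
  have hne : ({r, s} : Set E).Nonempty := ⟨r, by simp⟩
  rw [convexHull_insert (by simp), convexHull_insert hne, convexHull_pair] at hx
  simp only [convexJoin_singleton_left, Set.mem_iUnion] at hx
  obtain ⟨y, ⟨z, ⟨k, l, hk, hl, hkl, rfl⟩, k', l', hk', hl', hkl', rfl⟩,
    k'', l'', hk'', hl'', hkl'', rfl⟩ := hx
  refine ⟨k'', l'' * k', l'' * (l' * k), l'' * (l' * l), hk'', by positivity, by positivity,
    by positivity, ?_, by module⟩
  linear_combination hkl'' + l'' * hkl' + l'' * l' * hkl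

end ConvexHull

section AffineMap

variable (f : (Fin 3 → ℝ) →ᵃ[ℝ] ℝ) (a b c d : Fin 3 → ℝ)

theorem AffineMap.map_mp : f (mp a b) = (f a + f b) / 2 := by
  have hf (x : Fin 3 → ℝ) : f x = f.linear x + f 0 := congrFun f.decomp x
  rw [hf (mp a b), hf a, hf b]
  simp [mp]
  ring

theorem AffineMap.map_cT : f (cT a b c d) = (f a + f b + f c + f d) / 4 := by
  have hf (x : Fin 3 → ℝ) : f x = f.linear x + f 0 := congrFun f.decomp x
  rw [hf (cT a b c d), hf a, hf b, hf c, hf d]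
  simp [cT]
  ring

end AffineMap

theorem AffineIndependent.exists_affineMap_eq {a b c d : Fin 3 → ℝ}
    (h : AffineIndependent ℝ ![a, b, c, d]) (w : Fin 4 → ℝ) :
    ∃ f : (Fin 3 → ℝ) →ᵃ[ℝ] ℝ, f a = w 0 ∧ f b = w 1 ∧ f c = w 2 ∧ f d = w 3 := by
  have htop : affineSpan ℝ (Set.range ![a, b, c, d]) = ⊤ := by
    rw [h.affineSpan_eq_top_iff_card_eq_finrank_add_one]
    simp
  let B : AffineBasis (Fin 4) ℝ (Fin 3 → ℝ) := ⟨![a, b, c, d], h, htop⟩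
  let f : (Fin 3 → ℝ) →ᵃ[ℝ] ℝ :=
    w 0 • B.coord 0 + w 1 • B.coord 1 + w 2 • B.coord 2 + w 3 • B.coord 3
  have hf (i : Fin 4) : f (B i) = w i := by
    fin_cases i <;> simp [f]
  exact ⟨f, hf 0, hf 1, hf 2, hf 3⟩

theorem volume_setOf_affineMap_eq_zero (f : (Fin 3 → ℝ) →ᵃ[ℝ] ℝ) {p : Fin 3 → ℝ}
    (hp : f p ≠ 0) : volume {x | f x = 0} = 0 := by
  let S : AffineSubspace ℝ (Fin 3 → ℝ) := (AffineSubspace.mk' (0 : ℝ) ⊥).comap f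
  have hS : (S : Set (Fin 3 → ℝ)) = {x | f x = 0} := by
    ext x
    simp [S]
  rw [← hS]
  refine Measure.addHaar_affineSubspace volume S fun htop => hp ?_
  have : p ∈ (S : Set (Fin 3 → ℝ)) := by rw [htop]; trivial
  rwa [hS] at this

/-- Values at the four vertices of the seven affine functions whose zero sets are the planes
cutting a tetrahedron into its red refinement: the planes of the four inner faces of the corner
tetrahedra, and the three planes through the centroid, each containing two pairs of opposite
edge midpoints. -/
def redWall : Fin 7 → Fin 4 → ℤ :=
  ![![1, -1, -1, -1], ![-1, 1, -1, -1], ![-1, -1, 1, -1], ![-1, -1, -1, 1],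
    ![1, 1, -1, -1], ![1, -1, 1, -1], ![1, -1, -1, 1]]

/-- The sign of each function of `redWall` on each of the twelve subtetrahedra. -/
def redSide : Fin 12 → Fin 7 → ℤ :=
  ![![1, -1, -1, -1, 1, 1, 1], ![-1, 1, -1, -1, 1, -1, -1],
    ![-1, -1, 1, -1, -1, 1, -1], ![-1, -1, -1, 1, -1, -1, 1],
    ![-1, -1, -1, -1, 1, 1, 1], ![-1, -1, -1, -1, 1, -1, -1],
    ![-1, -1, -1, -1, -1, 1, -1], ![-1, -1, -1, -1, -1, -1, 1],
    ![-1, -1, -1, -1, 1, 1, -1], ![-1, -1, -1, -1, -1, 1, 1],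
    ![-1, -1, -1, -1, 1, -1, 1], ![-1, -1, -1, -1, -1, -1, -1]]

theorem exists_redSide_eq_neg {i j : Fin 12} (hij : i ≠ j) :
    ∃ k, redSide j k = -redSide i k ∧ redSide i k ≠ 0 := by
  revert i j
  decide

theorem convexHull_four_subset_halfspace {E : Type*} [AddCommGroup E] [Module ℝ E]
    {p q r s : E} (f : E →ᵃ[ℝ] ℝ) {ε : ℝ}
    (hp : 0 ≤ ε * f p) (hq : 0 ≤ ε * f q) (hr : 0 ≤ ε * f r) (hs : 0 ≤ ε * f s) :
    convexHull ℝ {p, q, r, s} ⊆ {x | 0 ≤ ε * f x} := by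
  refine convexHull_min ?_ ((convex_Ici (0 : ℝ)).affine_preimage (ε • f))
  rintro x (rfl | rfl | rfl | rfl) <;> assumption

theorem redPieces_subset_halfspace {a b c d : Fin 3 → ℝ} (f : (Fin 3 → ℝ) →ᵃ[ℝ] ℝ) (k : Fin 7)
    (ha : f a = redWall k 0) (hb : f b = redWall k 1) (hc : f c = redWall k 2)
    (hd : f d = redWall k 3) (i : Fin 12) :
    redPieces a b c d i ⊆ {x | 0 ≤ (redSide i k : ℝ) * f x} := by
  fin_cases i <;> refine convexHull_four_subset_halfspace f ?_ ?_ ?_ ?_ <;>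
    simp only [AffineMap.map_mp, AffineMap.map_cT, ha, hb, hc, hd, ← mul_div_assoc] <;>
    (try refine div_nonneg ?_ (by norm_num)) <;>
    clear ha hb hc hd <;> norm_cast <;> revert k <;> decide

theorem volume_redPieces_inter {a b c d : Fin 3 → ℝ} (h : AffineIndependent ℝ ![a, b, c, d])
    {i j : Fin 12} (hij : i ≠ j) :
    volume (redPieces a b c d i ∩ redPieces a b c d j) = 0 := by
  obtain ⟨k, hneg, hne⟩ := exists_redSide_eq_neg hij
  obtain ⟨f, ha, hb, hc, hd⟩ := h.exists_affineMap_eq fun n => (redWall k n : ℝ)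
  have hfa : f a ≠ 0 := by
    rw [ha]
    fin_cases k <;> simp [redWall]
  refine measure_mono_null ?_ (volume_setOf_affineMap_eq_zero f hfa)
  rintro x ⟨hi, hj⟩
  have hi' := redPieces_subset_halfspace f k ha hb hc hd i hi
  have hj' := redPieces_subset_halfspace f k ha hb hc hd j hj
  simp only [Set.mem_ofPred_eq, hneg, Int.cast_neg, neg_mul] at hi' hj' ⊢
  have hzero : (redSide i k : ℝ) * f x = 0 := by linarith
  exact (mul_eq_zero.mp hzero).resolve_left (by exact_mod_cast hne)

theorem mp_mem {s : Set (Fin 3 → ℝ)} (hs : Convex ℝ s) {x y : Fin 3 → ℝ} (hx : x ∈ s)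
    (hy : y ∈ s) : mp x y ∈ s := by
  rw [mp, smul_add]
  exact hs hx hy (by norm_num) (by norm_num) (by norm_num)

theorem redPieces_subset (a b c d : Fin 3 → ℝ) (i : Fin 12) :
    redPieces a b c d i ⊆ convexHull ℝ {a, b, c, d} := by
  have hT : Convex ℝ (convexHull ℝ {a, b, c, d}) := convex_convexHull ℝ _
  have ha : a ∈ convexHull ℝ {a, b, c, d} := subset_convexHull ℝ _ (by simp)
  have hb : b ∈ convexHull ℝ {a, b, c, d} := subset_convexHull ℝ _ (by simp)
  have hc : c ∈ convexHull ℝ {a, b, c, d} := subset_convexHull ℝ _ (by simp)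
  have hd : d ∈ convexHull ℝ {a, b, c, d} := subset_convexHull ℝ _ (by simp)
  have hcT : cT a b c d ∈ convexHull ℝ {a, b, c, d} := by
    have : cT a b c d = mp (mp a b) (mp c d) := by
      simp only [cT, mp]
      module
    rw [this]
    exact mp_mem hT (mp_mem hT ha hb) (mp_mem hT hc hd)
  fin_cases i <;> refine convexHull_min ?_ hT <;> rintro x (rfl | rfl | rfl | rfl) <;>
    first | assumption | (apply mp_mem hT <;> assumption)

theorem convexHull_subset_iUnion_redPieces (a b c d : Fin 3 → ℝ) :
    convexHull ℝ {a, b, c, d} ⊆ ⋃ i, redPieces a b c d i := by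
  intro x hx
  obtain ⟨t, u, v, w, ht, hu, hv, hw, hsum, rfl⟩ := exists_weights_of_mem_convexHull_four hx
  obtain rfl : w = 1 - t - u - v := by linarith
  rw [Set.mem_iUnion]
  rcases le_total (1 / 2) t with ha | ha
  · exact ⟨0, mem_convexHull_four_of_eq
      (t := 2 * t - 1) (u := 2 * u)
      (v := 2 * v) (w := 2 * (1 - t - u - v))
      (by linarith) (by linarith) (by linarith) (by linarith) (by ring)
      (by simp only [mp]; module)⟩
  rcases le_total (1 / 2) u with hb | hb
  · exact ⟨1, mem_convexHull_four_of_eq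
      (t := 2 * u - 1) (u := 2 * v)
      (v := 2 * t) (w := 2 * (1 - t - u - v))
      (by linarith) (by linarith) (by linarith) (by linarith) (by ring)
      (by simp only [mp]; module)⟩
  rcases le_total (1 / 2) v with hc | hc
  · exact ⟨2, mem_convexHull_four_of_eq
      (t := 2 * v - 1) (u := 2 * t)
      (v := 2 * u) (w := 2 * (1 - t - u - v))
      (by linarith) (by linarith) (by linarith) (by linarith) (by ring)
      (by simp only [mp]; module)⟩
  rcases le_total (1 / 2) (1 - t - u - v) with hd | hd
  · exact ⟨3, mem_convexHull_four_of_eq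
      (t := 2 * (1 - t - u - v) - 1) (u := 2 * v)
      (v := 2 * u) (w := 2 * t)
      (by linarith) (by linarith) (by linarith) (by linarith) (by ring)
      (by simp only [mp]; module)⟩
  rcases le_total (1 / 2) (t + u) with hab | hab <;>
    rcases le_total (1 / 2) (t + v) with hac | hac <;>
    rcases le_total (u + v) (1 / 2) with had | had
  · exact ⟨4, mem_convexHull_four_of_eq
      (t := 2 * t + 2 * u - 1) (u := 2 * t + 2 * v - 1)
      (v := 2 * t + 2 * (1 - t - u - v) - 1) (w := 2 - 4 * t)
      (by linarith) (by linarith) (by linarith) (by linarith) (by ring)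
      (by simp only [mp, cT]; module)⟩
  · exact ⟨8, mem_convexHull_four_of_eq
      (t := 1 - 2 * (1 - t - u - v) - 2 * v) (u := 1 - 2 * (1 - t - u - v) - 2 * t)
      (v := 1 - 2 * (1 - t - u - v) - 2 * u) (w := 4 * (1 - t - u - v))
      (by linarith) (by linarith) (by linarith) (by linarith) (by ring)
      (by simp only [mp, cT]; module)⟩
  · exact ⟨10, mem_convexHull_four_of_eq
      (t := 1 - 2 * v - 2 * (1 - t - u - v)) (u := 1 - 2 * v - 2 * u)
      (v := 1 - 2 * v - 2 * t) (w := 4 * v)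
      (by linarith) (by linarith) (by linarith) (by linarith) (by ring)
      (by simp only [mp, cT]; module)⟩
  · exact ⟨5, mem_convexHull_four_of_eq
      (t := 2 * u + 2 * v - 1) (u := 2 * u + 2 * t - 1)
      (v := 2 * u + 2 * (1 - t - u - v) - 1) (w := 2 - 4 * u)
      (by linarith) (by linarith) (by linarith) (by linarith) (by ring)
      (by simp only [mp, cT]; module)⟩
  · exact ⟨9, mem_convexHull_four_of_eq
      (t := 1 - 2 * u - 2 * (1 - t - u - v)) (u := 1 - 2 * u - 2 * t)
      (v := 1 - 2 * u - 2 * v) (w := 4 * u)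
      (by linarith) (by linarith) (by linarith) (by linarith) (by ring)
      (by simp only [mp, cT]; module)⟩
  · exact ⟨6, mem_convexHull_four_of_eq
      (t := 2 * v + 2 * t - 1) (u := 2 * v + 2 * u - 1)
      (v := 2 * v + 2 * (1 - t - u - v) - 1) (w := 2 - 4 * v)
      (by linarith) (by linarith) (by linarith) (by linarith) (by ring)
      (by simp only [mp, cT]; module)⟩
  · exact ⟨7, mem_convexHull_four_of_eq
      (t := 2 * (1 - t - u - v) + 2 * v - 1) (u := 2 * (1 - t - u - v) + 2 * u - 1)
      (v := 2 * (1 - t - u - v) + 2 * t - 1) (w := 2 - 4 * (1 - t - u - v))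
      (by linarith) (by linarith) (by linarith) (by linarith) (by ring)
      (by simp only [mp, cT]; module)⟩
  · exact ⟨11, mem_convexHull_four_of_eq
      (t := 1 - 2 * t - 2 * u) (u := 1 - 2 * t - 2 * (1 - t - u - v))
      (v := 1 - 2 * t - 2 * v) (w := 4 * t)
      (by linarith) (by linarith) (by linarith) (by linarith) (by ring)
      (by simp only [mp, cT]; module)⟩

theorem measurableSet_redPieces (a b c d : Fin 3 → ℝ) (i : Fin 12) :
    MeasurableSet (redPieces a b c d i) := by
  fin_cases i <;> exact (Set.Finite.isClosed_convexHull ℝ (by simp)).measurableSet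

/-- Correctness of the red refinement: the twelve subtetrahedra cover
`T = conv{a,b,c,d}`, overlap only in Lebesgue-null sets, and their volumes sum to
the volume of `T`. -/
theorem red_refinement
    (a b c d : Fin 3 → ℝ) (h : AffineIndependent ℝ ![a, b, c, d]) :
    (⋃ i, redPieces a b c d i) = convexHull ℝ {a, b, c, d} ∧
    (Pairwise fun i j : Fin 12 =>
      volume (redPieces a b c d i ∩ redPieces a b c d j) = 0) ∧
    ∑ i, volume (redPieces a b c d i) =
      volume (convexHull ℝ ({a, b, c, d} : Set (Fin 3 → ℝ))) := by
  have hcover : (⋃ i, redPieces a b c d i) = convexHull ℝ {a, b, c, d} :=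
    (Set.iUnion_subset (redPieces_subset a b c d)).antisymm
      (convexHull_subset_iUnion_redPieces a b c d)
  have hnull : Pairwise fun i j : Fin 12 =>
      volume (redPieces a b c d i ∩ redPieces a b c d j) = 0 :=
    fun _ _ hij => volume_redPieces_inter h hij
  refine ⟨hcover, hnull, ?_⟩
  rw [← hcover,
    measure_iUnion₀ hnull fun i => (measurableSet_redPieces a b c d i).nullMeasurableSet,
    tsum_fintype]
end
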